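/- arXiv:2101.03482 — 8 statements merged into one kernel-verified Lean document; each statement's English description precedes it below -/
import Mathlib

section
/- Let R be a principal ideal domain, fix a monomial ordering ≻ on the monomials of R[x_1,…,x_n], and let B = {b_1,…,b_s} be a finite set of nonconstant polynomials (b_j ∈ R[x_1,…,x_n] \ R). Then for every f ∈ R[x_1,…,x_n] there exist a nonzero multiplier λ ∈ R, quotients q_1,…,q_s ∈ R[x_1,…,x_n] and a remainder r ∈ R[x_1,…,x_n] such that λ·f = Σ_{j=1}^s q_j·b_j + r, the remainder r is pseudo-reduced with respect to B, and lm(f) = max{max_{1≤j≤s} lm(q_j·b_j), lm(r)}, the maximum being taken over the nonzero polynomials among the q_j·b_j and r (when f = 0 all of them vanish). -/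
open MvPolynomial

/-- A monomial ordering on the monomials (exponent vectors) in `m` variables:
a well-ordering compatible with addition of exponents. -/
structure MonomialOrdering (m : ℕ) where
  lin : LinearOrder (Fin m →₀ ℕ)
  wf : WellFounded lin.lt
  add_lt_add : ∀ a b c : Fin m →₀ ℕ, lin.lt a b → lin.lt (a + c) (b + c)

variable {m : ℕ}

open Classical in
/-- Leading monomial of `f` (junk value `0` for `f = 0`). -/
noncomputable def lmon {R : Type*} [CommRing R] (mo : MonomialOrdering m)
    (f : MvPolynomial (Fin m) R) : Fin m →₀ ℕ :=
  letI := mo.lin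
  if h : f = 0 then 0
  else f.support.max' (Finset.nonempty_iff_ne_empty.mpr
    (fun he => h (MvPolynomial.support_eq_empty.mp he)))

/-- Leading coefficient of `f`. -/
noncomputable def lcoeff {R : Type*} [CommRing R] (mo : MonomialOrdering m)
    (f : MvPolynomial (Fin m) R) : R :=
  f.coeff (lmon mo f)

/-- Leading term of `f`, as a polynomial. -/
noncomputable def lterm {R : Type*} [CommRing R] (mo : MonomialOrdering m)
    (f : MvPolynomial (Fin m) R) : MvPolynomial (Fin m) R :=
  MvPolynomial.monomial (lmon mo f) (lcoeff mo f)

/-- `f` is a nonconstant polynomial, i.e. `f ∉ R`. -/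
def Nonconst {R : Type*} [CommRing R] (f : MvPolynomial (Fin m) R) : Prop :=
  ∀ c : R, f ≠ MvPolynomial.C c

/-- `r` is pseudo-reduced with respect to `B`: no monomial in the support of `r` is
divisible by the leading monomial of an element of `B` (in particular `r = 0` is
pseudo-reduced). -/
def PseudoReduced {R : Type*} [CommRing R] (mo : MonomialOrdering m)
    (B : Finset (MvPolynomial (Fin m) R)) (r : MvPolynomial (Fin m) R) : Prop :=
  ∀ α ∈ r.support, ∀ b ∈ B, ¬ ∃ δ, α = lmon mo b + δ

namespace MonomialOrdering

/-- The submodule of polynomials all of whose monomials are at most `d`. -/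
noncomputable def polysLE (R : Type*) [CommRing R] (mo : MonomialOrdering m)
    (d : Fin m →₀ ℕ) : Submodule R (MvPolynomial (Fin m) R) :=
  MvPolynomial.restrictSupport R {α | mo.lin.le α d}

variable {R : Type*} [CommRing R] {mo : MonomialOrdering m} {d : Fin m →₀ ℕ}
  {f : MvPolynomial (Fin m) R}

theorem mem_polysLE : f ∈ mo.polysLE R d ↔ ∀ α ∈ f.support, mo.lin.le α d :=
  MvPolynomial.mem_restrictSupport_iff R

theorem polysLE_mono {e : Fin m →₀ ℕ} (h : mo.lin.le d e) : mo.polysLE R d ≤ mo.polysLE R e :=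
  MvPolynomial.restrictSupport_mono R fun _ hα => mo.lin.le_trans _ _ _ hα h

theorem lmon_mem_support (hf : f ≠ 0) : lmon mo f ∈ f.support := by
  let := mo.lin
  rw [lmon, dif_neg hf]
  exact Finset.max'_mem _ _

theorem mem_polysLE_lmon : f ∈ mo.polysLE R (lmon mo f) := by
  refine mem_polysLE.2 fun α hα => ?_
  let := mo.lin
  have hf : f ≠ 0 := by rintro rfl; simp at hα
  rw [lmon, dif_neg hf]
  exact Finset.le_max' _ _ hα

theorem lcoeff_ne_zero (hf : f ≠ 0) : lcoeff mo f ≠ 0 :=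
  MvPolynomial.mem_support_iff.1 (lmon_mem_support hf)

theorem lmon_le_of_mem_polysLE (hf : f ≠ 0) (h : f ∈ mo.polysLE R d) :
    mo.lin.le (lmon mo f) d :=
  mem_polysLE.1 h _ (lmon_mem_support hf)

theorem lmon_eq_of_mem_polysLE (h : f ∈ mo.polysLE R d) (hd : f.coeff d ≠ 0) :
    lmon mo f = d := by
  have hd' := MvPolynomial.mem_support_iff.2 hd
  have hf : f ≠ 0 := by rintro rfl; simp at hd
  exact mo.lin.le_antisymm _ _ (lmon_le_of_mem_polysLE hf h) (mem_polysLE.1 mem_polysLE_lmon _ hd')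

theorem lmon_lt_of_mem_polysLE (hf : f ≠ 0) (h : f ∈ mo.polysLE R d) (hd : f.coeff d = 0) :
    mo.lin.lt (lmon mo f) d := by
  refine @lt_of_le_of_ne _ mo.lin.toPartialOrder _ _ (lmon_le_of_mem_polysLE hf h) ?_
  rintro rfl
  exact lcoeff_ne_zero hf hd

theorem add_le_add_right {a b : Fin m →₀ ℕ} (h : mo.lin.le a b) (c : Fin m →₀ ℕ) :
    mo.lin.le (a + c) (b + c) := by
  rcases @eq_or_lt_of_le _ mo.lin.toPartialOrder _ _ h with rfl | h
  · exact mo.lin.le_refl _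
  · exact @le_of_lt _ mo.lin.toPreorder _ _ (mo.add_lt_add _ _ c h)

theorem monomial_mem_polysLE (d : Fin m →₀ ℕ) (c : R) :
    MvPolynomial.monomial d c ∈ mo.polysLE R d := by
  refine mem_polysLE.2 fun α hα => ?_
  rw [Finset.mem_singleton.1 (MvPolynomial.support_monomial_subset hα)]
  exact mo.lin.le_refl _

theorem monomial_mul_mem_polysLE (h : f ∈ mo.polysLE R d) (δ : Fin m →₀ ℕ) (c : R) :
    MvPolynomial.monomial δ c * f ∈ mo.polysLE R (d + δ) := by
  classical
  refine mem_polysLE.2 fun α hα => ?_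
  obtain ⟨β, hβ, γ, hγ, rfl⟩ := Finset.mem_add.1 (MvPolynomial.support_mul _ _ hα)
  rw [Finset.mem_singleton.1 (MvPolynomial.support_monomial_subset hβ), add_comm]
  exact add_le_add_right (mem_polysLE.1 h _ hγ) δ

/-- Pseudo-division with all summands bounded by a given monomial. -/
theorem exists_pseudo_division_le [IsDomain R] (B : Finset (MvPolynomial (Fin m) R))
    (hB : ∀ b ∈ B, b ≠ 0) (hf : f ∈ mo.polysLE R d) :
    ∃ (lam : R) (q : MvPolynomial (Fin m) R → MvPolynomial (Fin m) R)
      (r : MvPolynomial (Fin m) R),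
      lam ≠ 0 ∧ MvPolynomial.C lam * f = (∑ b ∈ B, q b * b) + r ∧ PseudoReduced mo B r ∧
      (∀ b ∈ B, q b * b ∈ mo.polysLE R d) ∧ r ∈ mo.polysLE R d := by
  classical
  induction d using mo.wf.induction generalizing f with
  | _ d ih =>
  have key : ∀ g ∈ mo.polysLE R d, g.coeff d = 0 →
      ∃ (lam : R) (q : MvPolynomial (Fin m) R → MvPolynomial (Fin m) R)
        (r : MvPolynomial (Fin m) R),
        lam ≠ 0 ∧ MvPolynomial.C lam * g = (∑ b ∈ B, q b * b) + r ∧ PseudoReduced mo B r ∧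
        (∀ b ∈ B, q b * b ∈ mo.polysLE R d) ∧ r ∈ mo.polysLE R d := by
    intro g hg hgd
    by_cases hg0 : g = 0
    · exact ⟨1, 0, 0, one_ne_zero, by simp [hg0], by simp [PseudoReduced], by simp, by simp⟩
    · have hlt := lmon_lt_of_mem_polysLE hg0 hg hgd
      have hmono := polysLE_mono (R := R) (@le_of_lt _ mo.lin.toPreorder _ _ hlt)
      obtain ⟨lam, q, r, h0, h1, h2, h3, h4⟩ := ih _ hlt mem_polysLE_lmon
      exact ⟨lam, q, r, h0, h1, h2, fun b hb => hmono (h3 b hb), hmono h4⟩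
  by_cases hred : ∃ b ∈ B, ∃ δ, d = lmon mo b + δ
  · obtain ⟨b, hb, δ, rfl⟩ := hred
    set d := lmon mo b + δ with hd
    have hmul (c : R) : MvPolynomial.monomial δ c * b ∈ mo.polysLE R d :=
      monomial_mul_mem_polysLE mem_polysLE_lmon δ c
    obtain ⟨lam, q, r, h0, h1, h2, h3, h4⟩ :=
      key (MvPolynomial.C (lcoeff mo b) * f - MvPolynomial.monomial δ (f.coeff d) * b)
        (Submodule.sub_mem _ (by
          rw [← MvPolynomial.smul_eq_C_mul]; exact Submodule.smul_mem _ _ hf) (hmul _))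
        (by
          have : (MvPolynomial.monomial δ (f.coeff d) * b).coeff d = f.coeff d * lcoeff mo b := by
            rw [hd, add_comm, MvPolynomial.coeff_monomial_mul, _root_.lcoeff]
          rw [MvPolynomial.coeff_sub, this, MvPolynomial.coeff_C_mul, mul_comm, sub_self])
    refine ⟨lam * lcoeff mo b, q + Pi.single b (MvPolynomial.monomial δ (lam * f.coeff d)), r,
      mul_ne_zero h0 (lcoeff_ne_zero (hB b hb)), ?_, h2, fun b' hb' => ?_, h4⟩
    · have hs : ∑ x ∈ B, (Pi.single b (MvPolynomial.monomial δ (lam * f.coeff d)) :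
          MvPolynomial (Fin m) R → MvPolynomial (Fin m) R) x * x =
          MvPolynomial.C lam * (MvPolynomial.monomial δ (f.coeff d) * b) := by
        rw [Finset.sum_eq_single_of_mem b hb fun x _ hx => by simp [Pi.single_eq_of_ne hx],
          Pi.single_eq_same, ← mul_assoc, MvPolynomial.C_mul_monomial]
      simp only [Pi.add_apply, add_mul, Finset.sum_add_distrib, hs, map_mul]
      linear_combination h1
    · rw [Pi.add_apply, add_mul]
      refine Submodule.add_mem _ (h3 b' hb') ?_
      by_cases h : b' = b
      · subst h
        rw [Pi.single_eq_same]
        exact hmul _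
      · simp [Pi.single_eq_of_ne h]
  · obtain ⟨lam, q, r, h0, h1, h2, h3, h4⟩ :=
      key (f - MvPolynomial.monomial d (f.coeff d))
        (Submodule.sub_mem _ hf (monomial_mem_polysLE _ _)) (by simp)
    refine ⟨lam, q, r + MvPolynomial.monomial d (lam * f.coeff d), h0, ?_, fun α hα b hb hdvd => ?_,
      h3, Submodule.add_mem _ h4 (monomial_mem_polysLE _ _)⟩
    · rw [← MvPolynomial.C_mul_monomial]
      linear_combination h1
    · rcases Finset.mem_union.1 (MvPolynomial.support_add hα) with hα | hα
      · exact h2 α hα b hb hdvd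
      · rw [Finset.mem_singleton.1 (MvPolynomial.support_monomial_subset hα)] at hdvd
        exact hred ⟨b, hb, hdvd⟩

end MonomialOrdering

/-- Pseudo-division over a PID: for a finite set `B` of nonconstant polynomials and any `f`,
there are a nonzero multiplier `λ`, quotients and a pseudo-reduced remainder with
`λ·f = Σ q_b·b + r` and `lm f = max{max_b lm(q_b·b), lm r}` over the nonzero summands
(all summands vanishing when `f = 0`). -/
theorem pseudo_division {R : Type*} [CommRing R] [IsDomain R] [IsPrincipalIdealRing R]
    (mo : MonomialOrdering m)
    (B : Finset (MvPolynomial (Fin m) R)) (hBne : B.Nonempty)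
    (hBnc : ∀ b ∈ B, Nonconst b)
    (f : MvPolynomial (Fin m) R) :
    ∃ (lam : R) (q : MvPolynomial (Fin m) R → MvPolynomial (Fin m) R)
      (r : MvPolynomial (Fin m) R),
      lam ≠ 0 ∧
      MvPolynomial.C lam * f = (∑ b ∈ B, q b * b) + r ∧
      PseudoReduced mo B r ∧
      (∀ b ∈ B, q b * b ≠ 0 → mo.lin.le (lmon mo (q b * b)) (lmon mo f)) ∧
      (r ≠ 0 → mo.lin.le (lmon mo r) (lmon mo f)) ∧
      (f ≠ 0 → (r ≠ 0 ∧ lmon mo r = lmon mo f) ∨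
        ∃ b ∈ B, q b * b ≠ 0 ∧ lmon mo (q b * b) = lmon mo f) ∧
      (f = 0 → r = 0 ∧ ∀ b ∈ B, q b * b = 0) := by
  by_cases hf : f = 0
  · exact ⟨1, 0, 0, by simp [hf, PseudoReduced]⟩
  obtain ⟨lam, q, r, h0, h1, h2, h3, h4⟩ :=
    MonomialOrdering.exists_pseudo_division_le (mo := mo) B
      (fun b hb h => hBnc b hb 0 (by rw [h, map_zero])) (MonomialOrdering.mem_polysLE_lmon (f := f))
  refine ⟨lam, q, r, h0, h1, h2,
    fun b hb hne => MonomialOrdering.lmon_le_of_mem_polysLE hne (h3 b hb),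
    fun hne => MonomialOrdering.lmon_le_of_mem_polysLE hne h4, fun _ => ?_, fun h => absurd h hf⟩
  have hne : MvPolynomial.coeff (lmon mo f) ((∑ b ∈ B, q b * b) + r) ≠ 0 := by
    rw [← h1, MvPolynomial.coeff_C_mul]
    exact mul_ne_zero h0 (MonomialOrdering.lcoeff_ne_zero hf)
  by_cases hr : r.coeff (lmon mo f) = 0
  · rw [MvPolynomial.coeff_add, hr, add_zero, MvPolynomial.coeff_sum] at hne
    obtain ⟨b, hb, hbne⟩ := Finset.exists_ne_zero_of_sum_ne_zero hne
    exact Or.inr ⟨b, hb, fun h => hbne (by rw [h, MvPolynomial.coeff_zero]),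
      MonomialOrdering.lmon_eq_of_mem_polysLE (h3 b hb) hbne⟩
  · exact Or.inl ⟨fun h => hr (by rw [h, MvPolynomial.coeff_zero]),
      MonomialOrdering.lmon_eq_of_mem_polysLE h4 hr⟩
end

section
/- Let R be a principal ideal domain, ≻ a monomial ordering, and f, g ∈ R[x_1,…,x_n] \ R nonconstant polynomials whose leading monomials are relatively prime, i.e. lcm(lm(f), lm(g)) = lm(f)·lm(g). Set d = gcd(lc f, lc g), f_1 = f − lt(f) and g_1 = g − lt(g). Then the S-polynomial satisfies d·S(f,g) = f_1·g − g_1·f, and, provided f_1 and g_1 are not both zero, lm(S(f,g)) = max{lm(f_1·g), lm(g_1·f)}, the maximum being over the nonzero polynomials among f_1·g and g_1·f. -/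
open MvPolynomial

variable {m : ℕ}

theorem MonomialOrdering.lin_zero_le (mo : MonomialOrdering m) (a : Fin m →₀ ℕ) :
    mo.lin.le 0 a := by
  by_contra h
  have ha : mo.lin.lt a 0 := (@not_le _ mo.lin _ _).mp h
  refine (mo.wf.has_min (Set.range fun k : ℕ => k • a) ⟨_, 0, rfl⟩).elim ?_
  rintro _ ⟨⟨k, rfl⟩, hk⟩
  refine hk ((k + 1) • a) ⟨k + 1, rfl⟩ ?_
  simpa [succ_nsmul, add_comm] using mo.add_lt_add a 0 (k • a) ha

theorem MonomialOrdering.lin_add_le_add (mo : MonomialOrdering m) (a b c : Fin m →₀ ℕ)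
    (h : mo.lin.le a b) : mo.lin.le (a + c) (b + c) := by
  rcases (@le_iff_lt_or_eq _ mo.lin.toPartialOrder a b).mp h with h | rfl
  · exact @le_of_lt _ mo.lin.toPreorder _ _ (mo.add_lt_add a b c h)
  · exact mo.lin.le_refl _

/-- A `MonomialOrdering` as a Mathlib `MonomialOrder`. -/
noncomputable def MonomialOrdering.toMonomialOrder (mo : MonomialOrdering m) :
    MonomialOrder (Fin m) where
  syn := Fin m →₀ ℕ
  addCommMonoidSyn := inferInstance
  linearOrderSyn := mo.lin
  isOrderedAddMonoid_syn :=
    @IsOrderedAddMonoid.mk _ _ mo.lin.toPreorder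
      (fun a b h c => mo.lin_add_le_add a b c h)
      (fun a b h c => by simpa only [add_comm c] using mo.lin_add_le_add a b c h)
  toSyn := AddEquiv.refl (Fin m →₀ ℕ)
  toSyn_monotone := by
    intro a b h
    obtain ⟨c, rfl⟩ := exists_add_of_le h
    have hc := mo.lin_add_le_add 0 c a (mo.lin_zero_le c)
    rw [zero_add, add_comm] at hc
    exact hc
  wellFoundedLT_syn := ⟨mo.wf⟩

theorem MonomialOrdering.toSyn_le_toSyn_iff (mo : MonomialOrdering m) (a b : Fin m →₀ ℕ) :
    mo.toMonomialOrder.toSyn a ≤ mo.toMonomialOrder.toSyn b ↔ mo.lin.le a b :=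
  Iff.rfl

theorem lmon_eq_degree {R : Type*} [CommRing R] (mo : MonomialOrdering m)
    (f : MvPolynomial (Fin m) R) : lmon mo f = mo.toMonomialOrder.degree f := by
  by_cases hf : f = 0
  · simp [lmon, hf]
  · rw [lmon, dif_neg hf]
    refine mo.lin.le_antisymm _ _ ?_ ?_
    · rw [← mo.toSyn_le_toSyn_iff]
      exact mo.toMonomialOrder.le_degree (@Finset.max'_mem _ mo.lin _ _)
    · exact @Finset.le_max' _ mo.lin _ _ (mo.toMonomialOrder.degree_mem_support hf)

theorem lcoeff_eq_leadingCoeff {R : Type*} [CommRing R] (mo : MonomialOrdering m)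
    (f : MvPolynomial (Fin m) R) :
    _root_.lcoeff mo f = mo.toMonomialOrder.leadingCoeff f := by
  rw [_root_.lcoeff, lmon_eq_degree, MonomialOrder.leadingCoeff]

theorem lterm_eq_leadingTerm {R : Type*} [CommRing R] (mo : MonomialOrdering m)
    (f : MvPolynomial (Fin m) R) : lterm mo f = mo.toMonomialOrder.leadingTerm f := by
  rw [lterm, lcoeff_eq_leadingCoeff, lmon_eq_degree, MonomialOrder.leadingTerm]

namespace MonomialOrder

variable {σ R : Type*} [CommRing R] (M : MonomialOrder σ)

/-- The difference of two polynomials with distinct degrees has the larger one as degree. -/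
theorem degree_sub_eq_max_of_degree_ne {p q : MvPolynomial σ R} (h0 : ¬ (p = 0 ∧ q = 0))
    (hne : p ≠ 0 → q ≠ 0 → M.degree p ≠ M.degree q) :
    p - q ≠ 0 ∧ (p ≠ 0 → M.degree p ≼[M] M.degree (p - q)) ∧
      (q ≠ 0 → M.degree q ≼[M] M.degree (p - q)) ∧
      ((p ≠ 0 ∧ M.degree (p - q) = M.degree p) ∨
        (q ≠ 0 ∧ M.degree (p - q) = M.degree q)) := by
  by_cases hp : p = 0
  · subst hp
    have hq : q ≠ 0 := by simpa using h0
    simp [hq, M.degree_neg]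
  by_cases hq : q = 0
  · subst hq
    simp [hp]
  have hpq := hne hp hq
  have hsub : p - q ≠ 0 := fun h => hpq (by rw [sub_eq_zero.mp h])
  rcases lt_or_gt_of_ne (M.toSyn.injective.ne hpq) with h | h
  · have hd : M.degree (p - q) = M.degree q := by
      rw [← neg_sub, M.degree_neg, M.degree_sub_of_lt h]
    simp [hsub, hp, hq, hd, h.le]
  · have hd := M.degree_sub_of_lt h
    simp [hsub, hp, hq, hd, h.le]

/-- For `f` and `g` of nonzero coprime degrees, the products of the tail of each with the other
have distinct degrees. -/
theorem degree_sub_leadingTerm_mul_ne [IsDomain R] {f g : MvPolynomial σ R}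
    (hf : M.degree f ≠ 0) (hcop : ∀ i, M.degree f i = 0 ∨ M.degree g i = 0)
    (hp : (f - M.leadingTerm f) * g ≠ 0) (hq : (g - M.leadingTerm g) * f ≠ 0) :
    M.degree ((f - M.leadingTerm f) * g) ≠ M.degree ((g - M.leadingTerm g) * f) := by
  intro h
  rw [M.degree_mul' hp, M.degree_mul' hq] at h
  have hle : M.degree f ≤ M.degree (f - M.leadingTerm f) := by
    intro i
    have hi := DFunLike.congr_fun h i
    simp only [Finsupp.add_apply] at hi
    rcases hcop i with h | h <;> omega
  exact absurd (M.toSyn_monotone hle) (not_le.mpr (M.degree_sub_leadingTerm_lt_degree hf))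

end MonomialOrder

theorem Nonconst.degree_ne_zero {R : Type*} [CommRing R] {f : MvPolynomial (Fin m) R}
    (hf : Nonconst f) (M : MonomialOrder (Fin m)) : M.degree f ≠ 0 :=
  fun h => hf _ (M.eq_C_of_degree_eq_zero h)


/-- For nonconstant `f, g` with relatively prime leading monomials (so that
`lcm(lm f, lm g) = lm f·lm g`), with `m = lcm(lc f, lc g)`, `d = gcd(lc f, lc g)`
(chosen with `d·m = lc f·lc g`) and cofactors `lc f·μ_f = m = lc g·μ_g`, the S-polynomial
`S(f,g) = μ_f·x^{lm g}·f − μ_g·x^{lm f}·g` satisfies `d·S(f,g) = f₁·g − g₁·f` where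
`f₁ = f − lt f`, `g₁ = g − lt g`; and, if `f₁`, `g₁` are not both zero,
`lm(S(f,g)) = max{lm(f₁·g), lm(g₁·f)}` over the nonzero summands. -/
theorem spoly_coprime_leadMonomials {R : Type*} [CommRing R] [IsDomain R]
    [IsPrincipalIdealRing R] (mo : MonomialOrdering m)
    (f g : MvPolynomial (Fin m) R) (hf : Nonconst f) (hg : Nonconst g)
    (hcop : ∀ i : Fin m, lmon mo f i = 0 ∨ lmon mo g i = 0)
    (d mlcm μf μg : R)
    (hd1 : d ∣ lcoeff mo f) (hd2 : d ∣ lcoeff mo g)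
    (hdgcd : ∀ e : R, e ∣ lcoeff mo f → e ∣ lcoeff mo g → e ∣ d)
    (hm1 : lcoeff mo f ∣ mlcm) (hm2 : lcoeff mo g ∣ mlcm)
    (hmlcm : ∀ e : R, lcoeff mo f ∣ e → lcoeff mo g ∣ e → mlcm ∣ e)
    (hμf : lcoeff mo f * μf = mlcm) (hμg : lcoeff mo g * μg = mlcm)
    (hdm : d * mlcm = lcoeff mo f * lcoeff mo g) :
    MvPolynomial.C d *
        (MvPolynomial.monomial (lmon mo g) μf * f -
          MvPolynomial.monomial (lmon mo f) μg * g)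
      = (f - lterm mo f) * g - (g - lterm mo g) * f ∧
    (¬ (f - lterm mo f = 0 ∧ g - lterm mo g = 0) →
      (MvPolynomial.monomial (lmon mo g) μf * f -
          MvPolynomial.monomial (lmon mo f) μg * g ≠ 0) ∧
      ((f - lterm mo f) * g ≠ 0 →
        mo.lin.le (lmon mo ((f - lterm mo f) * g))
          (lmon mo (MvPolynomial.monomial (lmon mo g) μf * f -
            MvPolynomial.monomial (lmon mo f) μg * g))) ∧
      ((g - lterm mo g) * f ≠ 0 →
        mo.lin.le (lmon mo ((g - lterm mo g) * f))
          (lmon mo (MvPolynomial.monomial (lmon mo g) μf * f -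
            MvPolynomial.monomial (lmon mo f) μg * g))) ∧
      (((f - lterm mo f) * g ≠ 0 ∧
          lmon mo (MvPolynomial.monomial (lmon mo g) μf * f -
            MvPolynomial.monomial (lmon mo f) μg * g) = lmon mo ((f - lterm mo f) * g)) ∨
       ((g - lterm mo g) * f ≠ 0 ∧
          lmon mo (MvPolynomial.monomial (lmon mo g) μf * f -
            MvPolynomial.monomial (lmon mo f) μg * g) = lmon mo ((g - lterm mo g) * f)))) := by
  have hf0 : f ≠ 0 := by simpa using hf 0
  have hg0 : g ≠ 0 := by simpa using hg 0
  have hlf : _root_.lcoeff mo f ≠ 0 := by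
    rw [lcoeff_eq_leadingCoeff]
    exact mo.toMonomialOrder.leadingCoeff_ne_zero_iff.mpr hf0
  have hlg : _root_.lcoeff mo g ≠ 0 := by
    rw [lcoeff_eq_leadingCoeff]
    exact mo.toMonomialOrder.leadingCoeff_ne_zero_iff.mpr hg0
  have hdf : d * μf = _root_.lcoeff mo g := by
    refine mul_left_cancel₀ hlf ?_
    linear_combination hdm + d * hμf
  have hdg : d * μg = _root_.lcoeff mo f := by
    refine mul_left_cancel₀ hlg ?_
    linear_combination hdm + d * hμg
  have key : MvPolynomial.C d *
        (MvPolynomial.monomial (lmon mo g) μf * f - MvPolynomial.monomial (lmon mo f) μg * g)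
      = (f - lterm mo f) * g - (g - lterm mo g) * f := by
    rw [mul_sub, ← mul_assoc, ← mul_assoc, C_mul_monomial, C_mul_monomial, hdf, hdg, lterm, lterm]
    ring
  refine ⟨key, fun h => ?_⟩
  generalize MvPolynomial.monomial (lmon mo g) μf * f -
    MvPolynomial.monomial (lmon mo f) μg * g = S at key ⊢
  simp only [lmon_eq_degree, lterm_eq_leadingTerm] at hcop h key ⊢
  simp only [← mo.toSyn_le_toSyn_iff]
  generalize mo.toMonomialOrder = M at *
  obtain ⟨h1, h2, h3, h4⟩ := M.degree_sub_eq_max_of_degree_ne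
    (p := (f - M.leadingTerm f) * g) (q := (g - M.leadingTerm g) * f)
    (by simpa [hf0, hg0] using h)
    (M.degree_sub_leadingTerm_mul_ne (hf.degree_ne_zero M) hcop)
  rw [← key] at h1 h2 h3 h4
  have hS : S ≠ 0 := right_ne_zero_of_mul h1
  have hdeg : M.degree (C d * S) = M.degree S := by
    rw [M.degree_mul' h1, M.degree_C, zero_add]
  rw [hdeg] at h2 h3 h4
  exact ⟨hS, h2, h3, h4⟩
end

section
/- Let R be a principal ideal domain, ≻ a monomial ordering, and f, g, h ∈ R[x_1,…,x_n] \ R nonconstant polynomials such that lm(h) divides lcm(lm(f), lm(g)). Set d = gcd(lcm(lc f, lc g), lc h) and λ = lc(h)/d. Then the quotients λ·lcm(lt f, lt g)/lcm(lt f, lt h) and λ·lcm(lt f, lt g)/lcm(lt h, lt g) are terms with coefficients in R (the coefficient quotients lie in R and the monomial quotients are genuine monomials), and the triangular identity λ·S(f,g) = (λ·lcm(lt f, lt g)/lcm(lt f, lt h))·S(f,h) − (λ·lcm(lt f, lt g)/lcm(lt h, lt g))·S(g,h) holds, where for terms one sets lcm(a·x^α, b·x^β) = lcm(a,b)·lcm(x^α,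 x^β). -/
open MvPolynomial

variable {m : ℕ}

theorem Nonconst.lcoeff_ne_zero {R : Type*} [CommRing R] (mo : MonomialOrdering m)
    {f : MvPolynomial (Fin m) R} (hf : Nonconst f) : lcoeff mo f ≠ 0 := by
  have hf0 : f ≠ 0 := fun h => hf 0 (by rw [h, map_zero])
  rw [_root_.lcoeff, ← MvPolynomial.mem_support_iff, lmon, dif_neg hf0]
  exact @Finset.max'_mem _ mo.lin _ _

theorem C_mul_monomial_eq_monomial_mul_monomial_of_cofactor {R : Type*} [CommRing R] [IsDomain R]
    {c l u a v M N : R} {α γ γ' δ : Fin m →₀ ℕ} (hc : c ≠ 0) (hu : c * u = M) (hv : c * v = N)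
    (h : l * M = a * N) (hα : α ≤ γ') (hγ : γ = γ' + δ) :
    MvPolynomial.C l * MvPolynomial.monomial (γ - α) u =
      MvPolynomial.monomial δ a * MvPolynomial.monomial (γ' - α) v := by
  have hcoeff : l * u = a * v := mul_left_cancel₀ hc (by
    subst hu hv
    linear_combination h)
  rw [MvPolynomial.C_mul_monomial, MvPolynomial.monomial_mul, hcoeff, hγ, add_comm γ' δ,
    add_tsub_assoc_of_le hα]

/-- Triangular identity: for nonconstant `f, g, h` with `lm h` dividing `lcm(lm f, lm g)`,
with lcm data for the three pairs of leading coefficients, `d = gcd(lcm(lc f, lc g), lc h)`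
and `λ = lc h / d`, the quotients `λ·lcm(lt f, lt g)/lcm(lt f, lt h)` and
`λ·lcm(lt f, lt g)/lcm(lt h, lt g)` are genuine terms with coefficients in `R`, and
`λ·S(f,g) = (λ·lcm(lt f,lt g)/lcm(lt f,lt h))·S(f,h) − (λ·lcm(lt f,lt g)/lcm(lt h,lt g))·S(g,h)`. -/
theorem spoly_triangular_identity {R : Type*} [CommRing R] [IsDomain R]
    [IsPrincipalIdealRing R] (mo : MonomialOrdering m)
    (f g h : MvPolynomial (Fin m) R)
    (hf : Nonconst f) (hg : Nonconst g) (hh : Nonconst h)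
    -- the lcm's of the leading monomials of the three pairs
    (γ γfh γgh : Fin m →₀ ℕ)
    (hγ : ∀ i, γ i = max (lmon mo f i) (lmon mo g i))
    (hγfh : ∀ i, γfh i = max (lmon mo f i) (lmon mo h i))
    (hγgh : ∀ i, γgh i = max (lmon mo g i) (lmon mo h i))
    -- `lm h` divides `lcm(lm f, lm g)`
    (hdvd : ∃ δ, γ = lmon mo h + δ)
    -- lcm's of the leading coefficients of the three pairs, with cofactors
    (mfg mfh mgh μf μg νf νh ρg ρh : R)
    (hμf : lcoeff mo f * μf = mfg) (hμg : lcoeff mo g * μg = mfg)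
    (hmfg : ∀ e : R, lcoeff mo f ∣ e → lcoeff mo g ∣ e → mfg ∣ e)
    (hνf : lcoeff mo f * νf = mfh) (hνh : lcoeff mo h * νh = mfh)
    (hmfh : ∀ e : R, lcoeff mo f ∣ e → lcoeff mo h ∣ e → mfh ∣ e)
    (hρg : lcoeff mo g * ρg = mgh) (hρh : lcoeff mo h * ρh = mgh)
    (hmgh : ∀ e : R, lcoeff mo g ∣ e → lcoeff mo h ∣ e → mgh ∣ e)
    -- `d = gcd(lcm(lc f, lc g), lc h)` and `λ = lc h / d`
    (d lam : R)
    (hd1 : d ∣ mfg) (hd2 : d ∣ lcoeff mo h)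
    (hdgcd : ∀ e : R, e ∣ mfg → e ∣ lcoeff mo h → e ∣ d)
    (hlam : d * lam = lcoeff mo h) :
    ∃ (a b : R) (δ₁ δ₂ : Fin m →₀ ℕ),
      lam * mfg = a * mfh ∧
      lam * mfg = b * mgh ∧
      γ = γfh + δ₁ ∧
      γ = γgh + δ₂ ∧
      MvPolynomial.C lam *
          (MvPolynomial.monomial (γ - lmon mo f) μf * f -
            MvPolynomial.monomial (γ - lmon mo g) μg * g)
        = MvPolynomial.monomial δ₁ a *
            (MvPolynomial.monomial (γfh - lmon mo f) νf * f -
              MvPolynomial.monomial (γfh - lmon mo h) νh * h)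
          - MvPolynomial.monomial δ₂ b *
              (MvPolynomial.monomial (γgh - lmon mo g) ρg * g -
                MvPolynomial.monomial (γgh - lmon mo h) ρh * h) := by
  obtain ⟨k, hk⟩ := hd1
  obtain ⟨ε, hε⟩ := hdvd
  have hh_mul : lcoeff mo h * k = lam * mfg := by
    rw [hk, ← hlam]
    ring
  have hh_dvd : lcoeff mo h ∣ lam * mfg := ⟨k, hh_mul.symm⟩
  obtain ⟨a, ha⟩ := hmfh (lam * mfg) (dvd_mul_of_dvd_right ⟨μf, hμf.symm⟩ _) hh_dvd
  obtain ⟨b, hb⟩ := hmgh (lam * mfg) (dvd_mul_of_dvd_right ⟨μg, hμg.symm⟩ _) hh_dvd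
  rw [mul_comm mfh] at ha
  rw [mul_comm mgh] at hb
  have hhγ : ∀ i, lmon mo h i ≤ γ i := fun i => by simp [hε]
  have hfh_le : γfh ≤ γ := fun i => by
    rw [hγfh]
    exact max_le (by simp [hγ]) (hhγ i)
  have hgh_le : γgh ≤ γ := fun i => by
    rw [hγgh]
    exact max_le (by simp [hγ]) (hhγ i)
  have hf_fh : lmon mo f ≤ γfh := fun i => by simp [hγfh]
  have hh_fh : lmon mo h ≤ γfh := fun i => by simp [hγfh]
  have hg_gh : lmon mo g ≤ γgh := fun i => by simp [hγgh]
  have hh_gh : lmon mo h ≤ γgh := fun i => by simp [hγgh]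
  have h₁ : γ = γfh + (γ - γfh) := (add_tsub_cancel_of_le hfh_le).symm
  have h₂ : γ = γgh + (γ - γgh) := (add_tsub_cancel_of_le hgh_le).symm
  refine ⟨a, b, γ - γfh, γ - γgh, ha, hb, h₁, h₂, ?_⟩
  have ef := C_mul_monomial_eq_monomial_mul_monomial_of_cofactor
    (hf.lcoeff_ne_zero mo) hμf hνf ha hf_fh h₁
  have eg := C_mul_monomial_eq_monomial_mul_monomial_of_cofactor
    (hg.lcoeff_ne_zero mo) hμg hρg hb hg_gh h₂
  have eh₁ := C_mul_monomial_eq_monomial_mul_monomial_of_cofactor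
    (hh.lcoeff_ne_zero mo) hh_mul hνh ((one_mul _).trans ha) hh_fh h₁
  have eh₂ := C_mul_monomial_eq_monomial_mul_monomial_of_cofactor
    (hh.lcoeff_ne_zero mo) hh_mul hρh ((one_mul _).trans hb) hh_gh h₂
  linear_combination f * ef - g * eg - h * eh₁ + h * eh₂
end

section
/- Let K be a perfect field. Let I be an ideal of K[x_1,…,x_n] with I ∩ K[x_1] = ⟨χ⟩ for some χ ∈ K[x_1] \ {0} (the eliminant of a zero-dimensional ideal), let χ_ε ∈ (I ∩ K[x_1]) \ {0}, and let G = {g_1,…,g_τ} ⊂ I \ K[x_1] be a finite set such that G ∪ {χ_ε} generates I. Let p ∈ K[x_1] be irreducible with mult_p(χ_ε) = i ≥ 1 (p^i divides χ_ε but p^{i+1} does not). Assume: (a) for every pair g_j ≠ g_t in G there exist a multiplier λ ∈ K[x_1] not divisible by p, quotients q_1,…,q_τ ∈ K[x_1,…,x_n] and ρ ∈ K[x_1] such that λ·S(g_j, g_t) = Σ_{k=1}^τ q_k·g_k + ρ·χ_ε and lm(q_k·g_k) ⪯ lm(S(g_j, g_t)) for every k with q_k·g_k ≠ 0; and (b)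 for every g ∈ G, p does not divide gcd(lc(g), χ_ε). Then mult_p(χ) = i; in particular p^i divides the eliminant χ. -/
open MvPolynomial

variable {m : ℕ}

/-- Uniqueness of the zero element in the span of a triangular family whose ties are resolved by
lower elements: an element all of whose leading functionals vanish is zero. -/
theorem eq_zero_of_mem_span_of_forall_apply_eq_zero {R M Γ J : Type*} [CommRing R]
    [AddCommGroup M] [Module R M] [LinearOrder Γ] [WellFoundedLT Γ]
    (φ : Γ → M →ₗ[R] R) (d : J → Γ) (v : J → M)
    (hunit : ∀ j, IsUnit (φ (d j) (v j)))
    (hlt : ∀ j δ, d j < δ → φ δ (v j) = 0)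
    (htie : ∀ j k, d j = d k →
      φ (d k) (v k) • v j - φ (d j) (v j) • v k ∈ Submodule.span R (v '' {l | d l < d j}))
    {f : M} (hf : f ∈ Submodule.span R (Set.range v)) (hφ : ∀ j, φ (d j) f = 0) :
    f = 0 := by
  have key : ∀ δ, ∀ f ∈ Submodule.span R (v '' {l | d l ≤ δ}), (∀ j, φ (d j) f = 0) → f = 0 := by
    intro δ
    induction δ using WellFoundedLT.induction with
    | ind δ ih =>
    intro f hf hφ
    have hlow : f ∈ Submodule.span R (v '' {l | d l < δ}) := by
      by_cases hj : ∃ j, d j = δ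
      · obtain ⟨j, rfl⟩ := hj
        have hdec : ∃ c : R, f - c • v j ∈ Submodule.span R (v '' {l | d l < d j}) := by
          clear hφ
          induction hf using Submodule.span_induction with
          | mem x hx =>
            obtain ⟨k, hk, rfl⟩ := hx
            rcases lt_or_eq_of_le (show d k ≤ d j from hk) with h | h
            · refine ⟨0, ?_⟩
              rw [zero_smul, sub_zero]
              exact Submodule.subset_span ⟨k, h, rfl⟩
            · obtain ⟨u, hu⟩ := hunit j
              refine ⟨(↑u⁻¹ : R) * φ (d k) (v k), ?_⟩
              have := Submodule.smul_mem _ (↑u⁻¹ : R) (htie k j h)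
              rw [← hu, smul_sub, smul_smul, smul_smul, Units.inv_mul, one_smul, h] at this
              rwa [h]
          | zero => exact ⟨0, by simp⟩
          | add x y _ _ hx hy =>
            obtain ⟨a, ha⟩ := hx
            obtain ⟨b, hb⟩ := hy
            refine ⟨a + b, ?_⟩
            convert Submodule.add_mem _ ha hb using 1
            rw [add_smul]; abel
          | smul a x _ hx =>
            obtain ⟨b, hb⟩ := hx
            refine ⟨a * b, ?_⟩
            convert Submodule.smul_mem _ a hb using 1
            rw [smul_sub, smul_smul]
        obtain ⟨c, hc⟩ := hdec
        have hker : Submodule.span R (v '' {l | d l < d j}) ≤ LinearMap.ker (φ (d j)) := by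
          rw [Submodule.span_le]
          rintro _ ⟨l, hl, rfl⟩
          exact hlt l _ hl
        have h0 := hker hc
        rw [LinearMap.mem_ker, map_sub, hφ j, map_smul, zero_sub, neg_eq_zero, smul_eq_mul,
          (hunit j).mul_left_eq_zero] at h0
        simpa [h0] using hc
      · refine Submodule.span_mono (Set.image_mono fun l hl => ?_) hf
        exact lt_of_le_of_ne hl fun h => hj ⟨l, h⟩
    have hstep : f = 0 ∨ ∃ ε < δ, f ∈ Submodule.span R (v '' {l | d l ≤ ε}) := by
      clear hf hφ
      induction hlow using Submodule.span_induction with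
      | mem x hx =>
        obtain ⟨k, hk, rfl⟩ := hx
        exact Or.inr ⟨d k, hk, Submodule.subset_span ⟨k, le_refl _, rfl⟩⟩
      | zero => exact Or.inl rfl
      | add x y _ _ hx hy =>
        rcases hx with rfl | ⟨a, ha, hxa⟩
        · simpa using hy
        rcases hy with rfl | ⟨b, hb, hyb⟩
        · exact Or.inr ⟨a, ha, by simpa using hxa⟩
        refine Or.inr ⟨max a b, max_lt ha hb, Submodule.add_mem _ ?_ ?_⟩
        · exact Submodule.span_mono
            (Set.image_mono fun l hl => le_trans (show d l ≤ a from hl) (le_max_left _ _)) hxa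
        · exact Submodule.span_mono
            (Set.image_mono fun l hl => le_trans (show d l ≤ b from hl) (le_max_right _ _)) hyb
      | smul a x _ hx =>
        rcases hx with rfl | ⟨b, hb, hxb⟩
        · simp
        · exact Or.inr ⟨b, hb, Submodule.smul_mem _ a hxb⟩
    rcases hstep with h | ⟨ε, hε, h⟩
    · exact h
    · exact ih ε hε f h hφ
  have hbound : f = 0 ∨ ∃ δ, f ∈ Submodule.span R (v '' {l | d l ≤ δ}) := by
    clear hφ
    induction hf using Submodule.span_induction with
    | mem x hx =>
      obtain ⟨k, rfl⟩ := hx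
      exact Or.inr ⟨d k, Submodule.subset_span ⟨k, le_refl _, rfl⟩⟩
    | zero => exact Or.inl rfl
    | add x y _ _ hx hy =>
      rcases hx with rfl | ⟨a, hxa⟩
      · simpa using hy
      rcases hy with rfl | ⟨b, hyb⟩
      · exact Or.inr ⟨a, by simpa using hxa⟩
      refine Or.inr ⟨max a b, Submodule.add_mem _ ?_ ?_⟩
      · exact Submodule.span_mono
          (Set.image_mono fun l hl => le_trans (show d l ≤ a from hl) (le_max_left _ _)) hxa
      · exact Submodule.span_mono
          (Set.image_mono fun l hl => le_trans (show d l ≤ b from hl) (le_max_right _ _)) hyb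
    | smul a x _ hx =>
      rcases hx with rfl | ⟨b, hxb⟩
      · simp
      · exact Or.inr ⟨b, Submodule.smul_mem _ a hxb⟩
  rcases hbound with h | ⟨δ, h⟩
  · exact h
  · exact key δ f h hφ

namespace MonomialOrdering

/-- The exponent vectors, ordered by a monomial ordering. -/
def Syn (_ : MonomialOrdering m) : Type := Fin m →₀ ℕ

noncomputable instance (mo : MonomialOrdering m) : AddCommMonoid mo.Syn :=
  inferInstanceAs (AddCommMonoid (Fin m →₀ ℕ))

instance (mo : MonomialOrdering m) : LinearOrder mo.Syn := mo.lin

instance (mo : MonomialOrdering m) : WellFoundedLT mo.Syn := ⟨mo.wf⟩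

instance (mo : MonomialOrdering m) : IsOrderedAddMonoid mo.Syn where
  add_le_add_left a b h c := by
    rcases lt_or_eq_of_le h with h | rfl
    · exact le_of_lt (mo.add_lt_add a b c h)
    · exact le_rfl

theorem zero_le_syn (mo : MonomialOrdering m) (a : mo.Syn) : 0 ≤ a := by
  by_contra! h
  obtain ⟨n, hn⟩ := WellFounded.not_rel_apply_succ (r := fun a b : mo.Syn => a < b)
    (fun n : ℕ => n • a)
  refine hn ?_
  have := mo.add_lt_add a 0 (n • a) h
  rw [succ_nsmul']
  exact lt_of_lt_of_eq (α := mo.Syn) this (zero_add (n • a))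

/-- The exponent vectors as elements of the ordered type `Syn`. -/
noncomputable def toSynEquiv (mo : MonomialOrdering m) : (Fin m →₀ ℕ) ≃+ mo.Syn where
  toEquiv := Equiv.refl _
  map_add' _ _ := rfl

/-- The Mathlib monomial order underlying a monomial ordering. -/
noncomputable def toMonomialOrder_s7 (mo : MonomialOrdering m) : MonomialOrder (Fin m) where
  syn := mo.Syn
  toSyn := mo.toSynEquiv
  toSyn_monotone a b h := by
    obtain ⟨c, rfl⟩ := exists_add_of_le h
    rw [map_add]
    exact le_add_of_nonneg_right (mo.zero_le_syn _)

theorem lmon_eq_degree {R : Type*} [CommRing R] (mo : MonomialOrdering m)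
    (f : MvPolynomial (Fin m) R) : lmon mo f = mo.toMonomialOrder_s7.degree f := by
  by_cases hf : f = 0
  · simp [hf, lmon]
  · have hmem := mo.toMonomialOrder_s7.degree_mem_support hf
    simp only [lmon, hf, dite_false]
    refine mo.lin.le_antisymm _ _ (@Finset.max'_le _ mo.lin _ _ _ fun b hb => ?_)
      (@Finset.le_max' _ mo.lin _ _ hmem)
    exact mo.toMonomialOrder_s7.le_degree hb

theorem lcoeff_eq_leadingCoeff {R : Type*} [CommRing R] (mo : MonomialOrdering m)
    (f : MvPolynomial (Fin m) R) : _root_.lcoeff mo f = mo.toMonomialOrder_s7.leadingCoeff f := by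
  rw [_root_.lcoeff, lmon_eq_degree]; rfl

end MonomialOrdering

section PseudoReduction

variable {σ A R : Type*} [CommRing A] [CommRing R]

/-- The image in `R[x]` of a monomial multiple of an element of `G`. -/
noncomputable def mappedMultiple (π : A →+* R) (G : Set (MvPolynomial σ A))
    (j : (σ →₀ ℕ) × G) : MvPolynomial σ R :=
  monomial j.1 1 * map π (j.2 : MvPolynomial σ A)

/-- The degree of a monomial multiple of an element of `G`. -/
noncomputable def multipleDegree (M : MonomialOrder σ) (G : Set (MvPolynomial σ A))
    (j : (σ →₀ ℕ) × G) : M.syn :=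
  M.toSyn (j.1 + M.degree (j.2 : MvPolynomial σ A))

theorem monomial_mul_map_mul_mem_span [IsDomain A] (M : MonomialOrder σ) (π : A →+* R)
    (G : Set (MvPolynomial σ A)) {g : MvPolynomial σ A} (hg : g ∈ G) (hg0 : g ≠ 0)
    (q : MvPolynomial σ A) (α : σ →₀ ℕ) {δ : M.syn}
    (hlt : q * g ≠ 0 → M.toSyn (α + M.degree (q * g)) < δ) :
    monomial α 1 * map π (q * g) ∈
      Submodule.span R (mappedMultiple π G '' {l | multipleDegree M G l < δ}) := by
  by_cases hq : q = 0
  · simp [hq]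
  specialize hlt (mul_ne_zero hq hg0)
  rw [M.degree_mul hq hg0] at hlt
  have hsum : monomial α 1 * map π (q * g) =
      ∑ a ∈ q.support, π (q.coeff a) • mappedMultiple π G (α + a, ⟨g, hg⟩) := by
    conv_lhs => rw [q.as_sum]
    rw [Finset.sum_mul, map_sum, Finset.mul_sum]
    refine Finset.sum_congr rfl fun a _ => ?_
    rw [map_mul, map_monomial, ← mul_assoc, monomial_mul, mappedMultiple, ← smul_mul_assoc,
      smul_monomial, smul_eq_mul, one_mul, mul_one]
  rw [hsum]
  refine Submodule.sum_mem _ fun a ha => Submodule.smul_mem _ _ (Submodule.subset_span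
    ⟨_, ?_, rfl⟩)
  refine lt_of_le_of_lt ?_ hlt
  simp only [multipleDegree, map_add, ← add_assoc]
  gcongr
  exact M.le_degree ha

theorem coeff_mappedMultiple_eq_zero_of_lt (M : MonomialOrder σ) (π : A →+* R)
    (G : Set (MvPolynomial σ A)) (j : (σ →₀ ℕ) × G) {δ : σ →₀ ℕ}
    (h : multipleDegree M G j < M.toSyn δ) : (mappedMultiple π G j).coeff δ = 0 := by
  classical
  rw [mappedMultiple, coeff_monomial_mul']
  split_ifs with hle
  · obtain ⟨c, rfl⟩ := exists_add_of_le hle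
    rw [multipleDegree, map_add, map_add, add_lt_add_iff_left] at h
    rw [add_tsub_cancel_left, coeff_map, M.coeff_eq_zero_of_lt h, map_zero, mul_zero]
  · rfl

theorem coeff_mappedMultiple_degree (M : MonomialOrder σ) (π : A →+* R)
    (G : Set (MvPolynomial σ A)) (j : (σ →₀ ℕ) × G) :
    (mappedMultiple π G j).coeff (M.toSyn.symm (multipleDegree M G j)) =
      π (M.leadingCoeff (j.2 : MvPolynomial σ A)) := by
  rw [multipleDegree, AddEquiv.symm_apply_apply, mappedMultiple, coeff_monomial_mul, one_mul,
    coeff_map, MonomialOrder.leadingCoeff]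

theorem map_mem_span_range_mappedMultiple (π : A →+* R) (G : Set (MvPolynomial σ A))
    {c : A} (hc : π c = 0) {f : MvPolynomial σ A} (hf : f ∈ Ideal.span (G ∪ {C c})) :
    map π f ∈ Submodule.span R (Set.range (mappedMultiple π G)) := by
  have hmono : ∀ (a : σ →₀ ℕ) (r : R), ∀ y ∈ Submodule.span R (Set.range (mappedMultiple π G)),
      monomial a r * y ∈ Submodule.span R (Set.range (mappedMultiple π G)) := by
    intro a r y hy
    induction hy using Submodule.span_induction with
    | mem x hx =>
      obtain ⟨⟨b, g⟩, rfl⟩ := hx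
      have : monomial a r * mappedMultiple π G (b, g) = r • mappedMultiple π G (a + b, g) := by
        rw [mappedMultiple, mappedMultiple, ← mul_assoc, monomial_mul, ← smul_mul_assoc,
          smul_monomial, smul_eq_mul]
      rw [this]
      exact Submodule.smul_mem _ _ (Submodule.subset_span ⟨_, rfl⟩)
    | zero => simp
    | add x y _ _ hx hy => rw [mul_add]; exact Submodule.add_mem _ hx hy
    | smul b x _ hx => rw [mul_smul_comm]; exact Submodule.smul_mem _ _ hx
  induction hf using Submodule.span_induction with
  | mem x hx =>
    rcases hx with hx | hx
    · refine Submodule.subset_span ⟨(0, ⟨x, hx⟩), ?_⟩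
      rw [mappedMultiple, ← C_apply, C_1, one_mul]
    · rw [Set.mem_singleton_iff.mp hx, map_C, hc, C_0]
      exact Submodule.zero_mem _
  | zero => simp
  | add x y _ _ hx hy => rw [map_add]; exact Submodule.add_mem _ hx hy
  | smul q x _ hx =>
    rw [smul_eq_mul, map_mul, (map π q).as_sum, Finset.sum_mul]
    exact Submodule.sum_mem _ fun a _ => hmono _ _ _ hx

/-- Divided S-polynomials cancel the least common multiple of the leading monomials. -/
theorem degree_monomial_mul_sub_lt (M : MonomialOrder σ) {g h : MvPolynomial σ A}
    (hg : M.degree g ≠ 0) {μ ν : A} (heq : M.leadingCoeff g * μ = M.leadingCoeff h * ν) :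
    M.toSyn (M.degree (monomial (M.degree g ⊔ M.degree h - M.degree g) μ * g -
      monomial (M.degree g ⊔ M.degree h - M.degree h) ν * h)) <
      M.toSyn (M.degree g ⊔ M.degree h) := by
  set γ := M.degree g ⊔ M.degree h with hγ
  have hγg : γ - M.degree g + M.degree g = γ := tsub_add_cancel_of_le le_sup_left
  have hγh : γ - M.degree h + M.degree h = γ := tsub_add_cancel_of_le le_sup_right
  have hγ0 : γ ≠ 0 := fun h0 => hg (le_antisymm (h0 ▸ le_sup_left) bot_le)
  have hbound : ∀ (f : MvPolynomial σ A) (r : A), γ - M.degree f + M.degree f = γ →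
      M.toSyn (M.degree (monomial (γ - M.degree f) r * f)) ≤ M.toSyn γ := by
    intro f r hf
    refine M.degree_mul_le.trans ?_
    conv_rhs => rw [← hf]
    rw [map_add, map_add]
    gcongr
    exact M.degree_monomial_le r
  refine lt_of_le_of_ne (M.degree_sub_le.trans (sup_le (hbound g μ hγg) (hbound h ν hγh)))
    fun hE => ?_
  have hE := M.toSyn.injective hE
  have hcoeff : ∀ (f : MvPolynomial σ A) (r : A), γ - M.degree f + M.degree f = γ →
      (monomial (γ - M.degree f) r * f).coeff γ = r * M.leadingCoeff f := by
    intro f r hf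
    have := coeff_monomial_mul (M.degree f) (γ - M.degree f) r f
    rwa [hf] at this
  have hS : monomial (γ - M.degree g) μ * g - monomial (γ - M.degree h) ν * h = 0 := by
    rw [← M.coeff_degree_eq_zero_iff, hE, coeff_sub, hcoeff g μ hγg, hcoeff h ν hγh,
      mul_comm μ, mul_comm ν, heq, sub_self]
  rw [hS, M.degree_zero] at hE
  exact hγ0 hE.symm

/-- If all leading coefficients of `G` become units in `R` and all divided S-polynomials of `G`
pseudo-reduce to zero in `R[x]` with multipliers becoming units, then the ideal generated by `G`
and a constant vanishing in `R` contains only constants vanishing in `R`. -/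
theorem map_eq_zero_of_C_mem_span [IsDomain A] (M : MonomialOrder σ) (π : A →+* R)
    (G : Finset (MvPolynomial σ A)) {c : A} (hc : π c = 0)
    (hdeg : ∀ g ∈ G, M.degree g ≠ 0) (hlc : ∀ g ∈ G, IsUnit (π (M.leadingCoeff g)))
    (hS : ∀ g ∈ G, ∀ h ∈ G, g ≠ h → ∃ (μ ν w lam ρ : A)
      (q : MvPolynomial σ A → MvPolynomial σ A),
      M.leadingCoeff g = ν * w ∧ M.leadingCoeff h = μ * w ∧ IsUnit (π lam) ∧
      C lam * (monomial (M.degree g ⊔ M.degree h - M.degree g) μ * g -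
          monomial (M.degree g ⊔ M.degree h - M.degree h) ν * h) =
        ∑ k ∈ G, q k * k + C ρ * C c ∧
      ∀ k ∈ G, q k * k ≠ 0 → M.toSyn (M.degree (q k * k)) ≤
        M.toSyn (M.degree (monomial (M.degree g ⊔ M.degree h - M.degree g) μ * g -
          monomial (M.degree g ⊔ M.degree h - M.degree h) ν * h)))
    {a : A} (ha : C a ∈ Ideal.span ((G : Set (MvPolynomial σ A)) ∪ {C c})) : π a = 0 := by
  have hmem := map_mem_span_range_mappedMultiple π _ hc ha
  rw [map_C] at hmem
  refine (C_eq_zero (σ := σ)).mp ?_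
  refine eq_zero_of_mem_span_of_forall_apply_eq_zero
    (fun δ : M.syn => MvPolynomial.lcoeff R (M.toSyn.symm δ))
    (multipleDegree M (G : Set (MvPolynomial σ A)))
    (mappedMultiple π (G : Set (MvPolynomial σ A))) ?_ ?_ ?_ hmem ?_
  · intro j
    rw [lcoeff_apply, coeff_mappedMultiple_degree]
    exact hlc _ j.2.2
  · intro j δ h
    rw [lcoeff_apply]
    exact coeff_mappedMultiple_eq_zero_of_lt M π _ j (by simpa using h)
  · rintro ⟨α, g, hg⟩ ⟨β, h, hh⟩ heq
    rw [lcoeff_apply, lcoeff_apply, coeff_mappedMultiple_degree, coeff_mappedMultiple_degree]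
    have hαβ : α + M.degree g = β + M.degree h := M.toSyn.injective heq
    by_cases hgh : g = h
    · subst hgh
      obtain rfl := add_right_cancel hαβ
      rw [sub_self]
      exact Submodule.zero_mem _
    obtain ⟨μ, ν, w, lam, ρ, q, hgw, hhw, hlam, hred, hle⟩ := hS g hg h hh hgh
    set γ := M.degree g ⊔ M.degree h with hγ
    obtain ⟨ε, hε⟩ := exists_add_of_le (show γ ≤ α + M.degree g from
      sup_le (le_add_self) (hαβ ▸ le_add_self))
    have hα : α = ε + (γ - M.degree g) := by
      refine add_right_cancel (b := M.degree g) ?_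
      rw [hε, add_assoc, tsub_add_cancel_of_le le_sup_left, add_comm]
    have hβ : β = ε + (γ - M.degree h) := by
      refine add_right_cancel (b := M.degree h) ?_
      rw [← hαβ, hε, add_assoc, tsub_add_cancel_of_le le_sup_right, add_comm]
    have hlt : M.toSyn (M.degree (monomial (γ - M.degree g) μ * g -
        monomial (γ - M.degree h) ν * h)) < M.toSyn γ :=
      degree_monomial_mul_sub_lt M (hdeg g hg) (by rw [hgw, hhw]; ring)
    obtain ⟨u, hu⟩ := hlam
    have key : π (M.leadingCoeff h) • mappedMultiple π (G : Set (MvPolynomial σ A)) (α, ⟨g, hg⟩) -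
        π (M.leadingCoeff g) • mappedMultiple π (G : Set (MvPolynomial σ A)) (β, ⟨h, hh⟩) =
        (π w * (↑u⁻¹ : R)) • ∑ k ∈ G, monomial ε 1 * map π (q k * k) := by
      have h1 := congrArg (fun f => monomial ε (1 : R) * map π f) hred
      simp only [map_add, map_mul (map π) (C lam), map_mul (map π) (C ρ), map_C, hc, C_0,
        mul_zero, add_zero] at h1
      rw [map_sum, Finset.mul_sum, ← hu, mul_left_comm, ← smul_eq_C_mul] at h1
      rw [← h1, smul_smul, mul_assoc, Units.inv_mul, mul_one, hgw, hhw, hα, hβ]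
      simp only [mappedMultiple, map_sub, map_mul, map_monomial, mul_sub, smul_sub,
        ← mul_assoc, monomial_mul, ← smul_mul_assoc, smul_monomial, smul_eq_mul, one_mul, mul_one,
        mul_comm (π w)]
    change π (M.leadingCoeff h) • _ - π (M.leadingCoeff g) • _ ∈ _
    rw [key]
    refine Submodule.smul_mem _ _ (Submodule.sum_mem _ fun k hk => ?_)
    refine monomial_mul_map_mul_mem_span M π _ hk (M.ne_zero_of_degree_ne_zero (hdeg k hk)) _ _
      fun hk0 => ?_
    change _ < M.toSyn (α + M.degree g)
    rw [hε, map_add, map_add, add_comm, add_lt_add_iff_right]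
    exact (hle k hk hk0).trans_lt hlt
  · rintro ⟨α, g, hg⟩
    classical
    rw [lcoeff_apply, coeff_C, if_neg]
    rw [multipleDegree, AddEquiv.symm_apply_apply]
    exact fun h0 => hdeg g hg (add_eq_zero.mp h0.symm).2

end PseudoReduction

/-- Compatibility theorem: let `K` be a perfect field, `I ⊆ (K[x₁])[x̃]` an ideal whose
intersection with `K[x₁]` is generated by the eliminant `χ ≠ 0`, `χ_ε` a nonzero element of
`I ∩ K[x₁]`, and `G ⊂ I \ K[x₁]` a finite set with `G ∪ {χ_ε}` generating `I`.  Let `p` be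
irreducible with `mult_p(χ_ε) = i ≥ 1`.  If (a) every S-polynomial of a pair of distinct
elements of `G` pseudo-reduces as `λ·S(g_j,g_t) = Σ q_k·g_k + ρ·χ_ε` with a multiplier `λ`
not divisible by `p` and `lm(q_k·g_k) ⪯ lm(S(g_j,g_t))` for the nonzero summands, and
(b) `p` does not divide `gcd(lc g, χ_ε)` for any `g ∈ G`, then `mult_p(χ) = i`; in
particular `p^i` divides the eliminant `χ`. -/
theorem compatible_divisor_divides_eliminant {K : Type*} [Field K] [PerfectField K]
    (mo : MonomialOrdering m)
    (I : Ideal (MvPolynomial (Fin m) (Polynomial K)))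
    (χ χε : Polynomial K) (hχ0 : χ ≠ 0)
    (hElim : ∀ c : Polynomial K, MvPolynomial.C c ∈ I ↔ χ ∣ c)
    (hχε0 : χε ≠ 0) (hχεI : MvPolynomial.C χε ∈ I)
    (G : Finset (MvPolynomial (Fin m) (Polynomial K)))
    (hGI : ∀ g ∈ G, g ∈ I) (hGnc : ∀ g ∈ G, Nonconst g)
    (hGen : I = Ideal.span (↑G ∪ {MvPolynomial.C χε}))
    (p : Polynomial K) (hp : Irreducible p)
    (i : ℕ) (hi : 1 ≤ i) (hpi : p ^ i ∣ χε) (hpi' : ¬ p ^ (i + 1) ∣ χε)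
    -- (a) pseudo-reduction of all S-polynomials of pairs from `G` with multipliers
    -- coprime to `p`
    (hA : ∀ gj ∈ G, ∀ gt ∈ G, gj ≠ gt →
      ∀ mlcm μ ν : Polynomial K,
        lcoeff mo gj * μ = mlcm → lcoeff mo gt * ν = mlcm →
        (∀ e : Polynomial K, lcoeff mo gj ∣ e → lcoeff mo gt ∣ e → mlcm ∣ e) →
        ∀ γ : Fin m →₀ ℕ, (∀ x, γ x = max (lmon mo gj x) (lmon mo gt x)) →
        ∃ (lam ρ : Polynomial K)
          (q : MvPolynomial (Fin m) (Polynomial K) → MvPolynomial (Fin m) (Polynomial K)),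
          ¬ p ∣ lam ∧
          MvPolynomial.C lam *
              (MvPolynomial.monomial (γ - lmon mo gj) μ * gj -
                MvPolynomial.monomial (γ - lmon mo gt) ν * gt)
            = (∑ gk ∈ G, q gk * gk) + MvPolynomial.C ρ * MvPolynomial.C χε ∧
          (∀ gk ∈ G, q gk * gk ≠ 0 →
            mo.lin.le (lmon mo (q gk * gk))
              (lmon mo (MvPolynomial.monomial (γ - lmon mo gj) μ * gj -
                MvPolynomial.monomial (γ - lmon mo gt) ν * gt))))
    -- (b) `p` does not divide `gcd(lc g, χ_ε)` for any `g ∈ G`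
    (hB : ∀ g ∈ G, ∀ d : Polynomial K,
      d ∣ lcoeff mo g → d ∣ χε →
      (∀ e : Polynomial K, e ∣ lcoeff mo g → e ∣ χε → e ∣ d) → ¬ p ∣ d) :
    p ^ i ∣ χ ∧ ¬ p ^ (i + 1) ∣ χ := by
  have hχI : MvPolynomial.C χ ∈ I := (hElim χ).mpr dvd_rfl
  refine ⟨?_, fun h => hpi' (h.trans ((hElim χε).mp hχεI))⟩
  classical
  have hunit : ∀ a : Polynomial K, ¬ p ∣ a →
      IsUnit (Ideal.Quotient.mk (Ideal.span {p ^ i}) a) := by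
    intro a ha
    obtain ⟨x, y, hxy⟩ := (((hp.coprime_iff_not_dvd).mpr ha).pow_left (m := i)).symm
    refine IsUnit.of_mul_eq_one (Ideal.Quotient.mk _ x) ?_
    rw [← map_mul, ← map_one (Ideal.Quotient.mk _), Ideal.Quotient.eq,
      Ideal.mem_span_singleton, ← hxy]
    exact ⟨-y, by ring⟩
  have hvan : ∀ a : Polynomial K, Ideal.Quotient.mk (Ideal.span {p ^ i}) a = 0 ↔ p ^ i ∣ a :=
    fun a => by rw [Ideal.Quotient.eq_zero_iff_mem, Ideal.mem_span_singleton]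
  have hpχε : p ∣ χε := (dvd_pow_self p (by omega)).trans hpi
  have hlc : ∀ g ∈ G, ¬ p ∣ lcoeff mo g := fun g hg hdvd =>
    hB g hg (EuclideanDomain.gcd (lcoeff mo g) χε) (EuclideanDomain.gcd_dvd_left _ _)
      (EuclideanDomain.gcd_dvd_right _ _) (fun _ => EuclideanDomain.dvd_gcd)
      (EuclideanDomain.dvd_gcd hdvd hpχε)
  simp only [mo.lmon_eq_degree, mo.lcoeff_eq_leadingCoeff] at hA hlc
  rw [hGen] at hχI
  refine (hvan χ).mp (map_eq_zero_of_C_mem_span mo.toMonomialOrder_s7 _ G ((hvan χε).mpr hpi)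
    (fun g hg h0 => hGnc g hg _ (MonomialOrder.eq_C_of_degree_eq_zero h0))
    (fun g hg => hunit _ (hlc g hg)) ?_ hχI)
  intro g hg h hh hgh
  have hg0 : mo.toMonomialOrder_s7.leadingCoeff g ≠ 0 := fun h0 => hlc g hg (h0 ▸ dvd_zero p)
  have hh0 : mo.toMonomialOrder_s7.leadingCoeff h ≠ 0 := fun h0 => hlc h hh (h0 ▸ dvd_zero p)
  obtain ⟨μ, hμ⟩ := EuclideanDomain.dvd_lcm_left (mo.toMonomialOrder_s7.leadingCoeff g)
    (mo.toMonomialOrder_s7.leadingCoeff h)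
  obtain ⟨ν, hν⟩ := EuclideanDomain.dvd_lcm_right (mo.toMonomialOrder_s7.leadingCoeff g)
    (mo.toMonomialOrder_s7.leadingCoeff h)
  obtain ⟨w, hw⟩ := EuclideanDomain.lcm_dvd
    (dvd_mul_right (mo.toMonomialOrder_s7.leadingCoeff g) (mo.toMonomialOrder_s7.leadingCoeff h))
    (dvd_mul_left (mo.toMonomialOrder_s7.leadingCoeff h) (mo.toMonomialOrder_s7.leadingCoeff g))
  obtain ⟨lam, ρ, q, hlam, hred, hle⟩ := hA g hg h hh hgh _ μ ν hμ.symm hν.symm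
    (fun _ => EuclideanDomain.lcm_dvd)
    (mo.toMonomialOrder_s7.degree g ⊔ mo.toMonomialOrder_s7.degree h) (fun _ => rfl)
  refine ⟨μ, ν, w, lam, ρ, q, ?_, ?_, hunit _ hlam, hred, hle⟩
  · refine mul_left_cancel₀ hh0 ?_
    rw [mul_comm, hw, hν, mul_assoc]
  · refine mul_left_cancel₀ hg0 ?_
    rw [hw, hμ, mul_assoc]
end

section
/- Let R be a principal ideal domain and q = u·∏_{i=1}^s p_i^{α_i}, where u is a unit, the p_i are irreducible and pairwise non-associated, and α_i ≥ 1. Let σ: R → R̄ = R/⟨q⟩ be the canonical projection. Then for every i with 1 ≤ i ≤ s and every integer l ≥ α_i, the image σ(p_i)^l is an associate of σ(p_i)^{α_i} in R̄: there exists a unit v ∈ R̄ with σ(p_i)^l = v·σ(p_i)^{α_i}. -/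
theorem IsCoprime.isUnit_mk_span_singleton {R : Type*} [CommRing R] {v q : R}
    (h : IsCoprime v q) : IsUnit (Ideal.Quotient.mk (Ideal.span {q}) v) := by
  obtain ⟨a, b, hab⟩ := h
  refine IsUnit.of_mul_eq_one (Ideal.Quotient.mk (Ideal.span {q}) a) ?_
  rw [← map_mul, ← map_one (Ideal.Quotient.mk (Ideal.span {q})),
    Ideal.Quotient.mk_eq_mk_iff_sub_mem, Ideal.mem_span_singleton]
  exact ⟨-b, by linear_combination hab⟩

theorem IsCoprime.exists_isUnit_mk_pow_eq_mul {R : Type*} [CommRing R] {x m : R}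
    (h : IsCoprime x m) {a l : ℕ} (hl : a ≤ l) :
    ∃ v : R ⧸ Ideal.span {x ^ a * m}, IsUnit v ∧
      (Ideal.Quotient.mk (Ideal.span {x ^ a * m}) x) ^ l
        = v * (Ideal.Quotient.mk (Ideal.span {x ^ a * m}) x) ^ a := by
  obtain ⟨k, rfl⟩ := Nat.exists_eq_add_of_le hl
  rcases k with _ | k
  · exact ⟨1, isUnit_one, by simp⟩
  refine ⟨Ideal.Quotient.mk _ (x ^ (k + 1) + m), ?_, ?_⟩
  · apply IsCoprime.isUnit_mk_span_singleton
    refine IsCoprime.mul_right (IsCoprime.pow_right ?_) ?_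
    · rw [pow_succ', add_comm]
      exact h.symm.add_mul_left_left _
    · simpa using (h.pow_left (m := k + 1)).add_mul_left_left 1
  · rw [← map_pow, ← map_pow, ← map_mul, Ideal.Quotient.mk_eq_mk_iff_sub_mem,
      Ideal.mem_span_singleton]
    exact ⟨-1, by ring⟩

/-- Let `R` be a PID and `q = u·∏ p_i^{α_i}` with `u` a unit, the `p_i` irreducible and
pairwise non-associated, and `α_i ≥ 1`.  Then in `R̄ = R/⟨q⟩`, for every `i` and every
`l ≥ α_i`, the image of `p_i^l` is an associate of the image of `p_i^{α_i}`. -/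
theorem pow_image_associate_in_PQR {R : Type*} [CommRing R] [IsDomain R]
    [IsPrincipalIdealRing R]
    (s : ℕ) (p : Fin s → R) (α : Fin s → ℕ) (u : Rˣ)
    (hirr : ∀ i, Irreducible (p i))
    (hassoc : ∀ i j, i ≠ j → ¬ Associated (p i) (p j))
    (hα : ∀ i, 1 ≤ α i)
    (q : R) (hq : q = ↑u * ∏ i, p i ^ α i)
    (i : Fin s) (l : ℕ) (hl : α i ≤ l) :
    ∃ v : R ⧸ Ideal.span {q}, IsUnit v ∧
      (Ideal.Quotient.mk (Ideal.span {q}) (p i)) ^ l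
        = v * (Ideal.Quotient.mk (Ideal.span {q}) (p i)) ^ (α i) := by
  have hcop : IsCoprime (p i) (↑u * ∏ j ∈ Finset.univ.erase i, p j ^ α j) := by
    rw [isCoprime_mul_unit_left_right u.isUnit]
    refine IsCoprime.prod_right fun j hj => IsCoprime.pow_right ?_
    refine (hirr i).coprime_iff_not_dvd.mpr fun hdvd => ?_
    exact hassoc i j (Finset.ne_of_mem_erase hj).symm
      ((hirr i).associated_of_dvd (hirr j) hdvd)
  have hq' : q = p i ^ α i * (↑u * ∏ j ∈ Finset.univ.erase i, p j ^ α j) := by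
    rw [hq, ← Finset.mul_prod_erase Finset.univ _ (Finset.mem_univ i)]
    ring
  subst hq'
  exact hcop.exists_isUnit_mk_pow_eq_mul hl
end

section
/- Let K be a field, q ∈ K[x_1] nonconstant, R̄ = K[x_1]/⟨q⟩, and fix a monomial ordering on the x̃-monomials of R̄[x̃]. Let B ⊂ R̄[x̃] \ R̄ be a finite set of nonconstant polynomials and c·x̃^α a term with c ∈ R̄ \ {0}. Then c·x̃^α belongs to the ideal ⟨{lt(b) : b ∈ B}⟩ of R̄[x̃] if and only if c·x̃^α is gcd-reducible with respect to B, i.e. if and only if the set B|_{x̃^α} = {b ∈ B : lm(b) divides x̃^α} is nonempty and c lies in the ideal of R̄ generated by {lc(b) : b ∈ B|_{x̃^α}}. -/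
open MvPolynomial

variable {m : ℕ}

/-- A nonzero term `c·x̃^α` is gcd-reducible with respect to a finite set `B` of
nonconstant polynomials if some `lm b` (`b ∈ B`) divides `x̃^α` and `c` lies in the ideal
generated by the leading coefficients of those `b ∈ B` whose leading monomial divides
`x̃^α`. -/
def GcdReducible {R : Type*} [CommRing R] (mo : MonomialOrdering m)
    (B : Finset (MvPolynomial (Fin m) R)) (c : R) (α : Fin m →₀ ℕ) : Prop :=
  (∃ b ∈ B, ∃ δ, α = lmon mo b + δ) ∧
  c ∈ Ideal.span {d : R | ∃ b ∈ B, (∃ δ, α = lmon mo b + δ) ∧ d = lcoeff mo b}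

open Classical in
theorem MvPolynomial.coeff_mem_span_of_mem_span_monomial {σ ι R : Type*} [CommRing R]
    (s : Set ι) (e : ι → σ →₀ ℕ) (a : ι → R) {f : MvPolynomial σ R}
    (hf : f ∈ Ideal.span ((fun i => monomial (e i) (a i)) '' s)) (α : σ →₀ ℕ) :
    f.coeff α ∈ Ideal.span {d : R | ∃ i ∈ s, (∃ δ, α = e i + δ) ∧ d = a i} := by
  induction hf using Submodule.span_induction generalizing α with
  | mem x hx =>
    obtain ⟨i, hi, rfl⟩ := hx
    rw [coeff_monomial]
    split_ifs with h
    · exact Ideal.subset_span ⟨i, hi, ⟨0, by simp [h]⟩, rfl⟩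
    · exact zero_mem _
  | zero => simp
  | add x y _ _ hx hy => rw [coeff_add]; exact add_mem (hx α) (hy α)
  | smul p x _ hx =>
    rw [smul_eq_mul, coeff_mul]
    refine Ideal.sum_mem _ fun z hz => Ideal.mul_mem_left _ _ ?_
    refine Ideal.span_mono ?_ (hx z.2)
    rintro d ⟨i, hi, ⟨δ, hδ⟩, rfl⟩
    refine ⟨i, hi, ⟨δ + z.1, ?_⟩, rfl⟩
    rw [← Finset.HasAntidiagonal.mem_antidiagonal.mp hz, hδ]
    abel

theorem MvPolynomial.monomial_mem_span_monomial {σ ι R : Type*} [CommRing R]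
    (s : Set ι) (e : ι → σ →₀ ℕ) (a : ι → R) {α : σ →₀ ℕ} {c : R}
    (hc : c ∈ Ideal.span {d : R | ∃ i ∈ s, (∃ δ, α = e i + δ) ∧ d = a i}) :
    monomial α c ∈ Ideal.span ((fun i => monomial (e i) (a i)) '' s) := by
  induction hc using Submodule.span_induction with
  | mem x hx =>
    obtain ⟨i, hi, ⟨δ, rfl⟩, rfl⟩ := hx
    have h : monomial (e i + δ) (a i) = monomial δ 1 * monomial (e i) (a i) := by
      rw [monomial_mul, one_mul, add_comm]
    rw [h]
    exact Ideal.mul_mem_left _ _ (Ideal.subset_span ⟨i, hi, rfl⟩)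
  | zero => simp
  | add x y _ _ hx hy => rw [map_add]; exact add_mem hx hy
  | smul r x _ hx =>
    rw [smul_eq_mul, ← C_mul_monomial]
    exact Ideal.mul_mem_left _ _ hx

theorem monomial_mem_span_lterm_iff {R : Type*} [CommRing R] (mo : MonomialOrdering m)
    (B : Finset (MvPolynomial (Fin m) R)) {c : R} (hc : c ≠ 0) (α : Fin m →₀ ℕ) :
    monomial α c ∈ Ideal.span ((fun b => lterm mo b) '' (B : Set (MvPolynomial (Fin m) R))) ↔
      GcdReducible mo B c α := by
  classical
  simp only [GcdReducible, lterm]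
  constructor
  swap
  · rintro ⟨-, h⟩
    apply monomial_mem_span_monomial
    simpa only [Finset.mem_coe] using h
  intro h
  have hmem := coeff_mem_span_of_mem_span_monomial _ (lmon mo) (lcoeff mo) h α
  rw [coeff_monomial, if_pos rfl] at hmem
  simp only [Finset.mem_coe] at hmem
  refine ⟨?_, hmem⟩
  by_contra hne
  refine hc ?_
  rw [Set.eq_empty_of_forall_notMem (s := {d | _}) ?_, Ideal.span_empty, Ideal.mem_bot] at hmem
  · exact hmem
  · rintro d ⟨b, hb, hd, -⟩
    exact hne ⟨b, hb, hd⟩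

/-- Over `R̄ = K[x₁]/⟨q⟩`, a nonzero term `c·x̃^α` belongs to the ideal generated by the
leading terms of a finite set `B` of nonconstant polynomials if and only if it is
gcd-reducible with respect to `B`. -/
theorem term_mem_leadTerm_span_iff_gcdReducible {K : Type*} [Field K]
    (q : Polynomial K) (hq : 0 < q.natDegree)
    (mo : MonomialOrdering m)
    (B : Finset (MvPolynomial (Fin m) (Polynomial K ⧸ Ideal.span {q})))
    (hBnc : ∀ b ∈ B, Nonconst b)
    (c : Polynomial K ⧸ Ideal.span {q}) (hc : c ≠ 0) (α : Fin m →₀ ℕ) :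
    (MvPolynomial.monomial α c ∈
        Ideal.span ((fun b => lterm mo b) ''
          (↑B : Set (MvPolynomial (Fin m) (Polynomial K ⧸ Ideal.span {q}))))) ↔
      GcdReducible mo B c α := by
  exact monomial_mem_span_lterm_iff mo B hc α
end

section
/- Let K be a field, q ∈ K[x_1] nonconstant, R̄ = K[x_1]/⟨q⟩, fix a monomial ordering on the x̃-monomials of R̄[x̃], and let F = {f_1,…,f_s} ⊂ R̄[x̃] \ R̄ be a finite set of nonconstant polynomials. For every f ∈ R̄[x̃] there exist a unit λ ∈ R̄^×, quotients q_1,…,q_s ∈ R̄[x̃] and a remainder r ∈ R̄[x̃] such that λ·f = Σ_{j=1}^s q_j·f_j + r, the remainder r is properly reduced with respect to F (no term c·x̃^α of r satisfies, for some j, that lm(f_j) divides x̃^α and c lies in the ideal of R̄ generated by lc(f_j)), and lm(f) = max{max_j lm(q_j)·lm(f_j), lm(r)}, the maximum being over the nonzero q_j and nonzero r. -/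
open MvPolynomial

variable {m : ℕ}

/-- `r` is properly reduced with respect to `F`: no term `c·x̃^α` of `r` satisfies, for
some `f ∈ F`, that `lm f` divides `x̃^α` and `c` lies in the ideal generated by `lc f`. -/
def ProperlyReduced {R : Type*} [CommRing R] (mo : MonomialOrdering m)
    (F : Finset (MvPolynomial (Fin m) R)) (r : MvPolynomial (Fin m) R) : Prop :=
  ∀ α ∈ r.support, ¬ ∃ f ∈ F, (∃ δ, α = lmon mo f + δ) ∧ lcoeff mo f ∣ r.coeff α

section Division

variable {R : Type*} [CommRing R] (mo : MonomialOrdering m)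

theorem lmon_mem_support {f : MvPolynomial (Fin m) R} (hf : f ≠ 0) : lmon mo f ∈ f.support := by
  unfold lmon
  rw [dif_neg hf]
  exact @Finset.max'_mem _ mo.lin _ _

theorem le_lmon {f : MvPolynomial (Fin m) R} {β : Fin m →₀ ℕ} (hβ : β ∈ f.support) :
    mo.lin.le β (lmon mo f) := by
  have hf : f ≠ 0 := by
    rintro rfl
    simp at hβ
  unfold lmon
  rw [dif_neg hf]
  exact @Finset.le_max' _ mo.lin _ _ hβ

theorem MonomialOrdering.add_le_add {a b : Fin m →₀ ℕ} (h : mo.lin.le a b) (c : Fin m →₀ ℕ) :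
    mo.lin.le (a + c) (b + c) := by
  rcases (@le_iff_lt_or_eq _ mo.lin.toPartialOrder a b).1 h with h | rfl
  · exact @le_of_lt _ mo.lin.toPreorder _ _ (mo.add_lt_add a b c h)
  · exact mo.lin.le_refl _

/-- Cancelling the leading term of `f` leaves only smaller monomials. -/
theorem lt_lmon_of_mem_support_sub {f g : MvPolynomial (Fin m) R}
    (hcoeff : g.coeff (lmon mo f) = f.coeff (lmon mo f))
    (hg : ∀ β ∈ g.support, mo.lin.le β (lmon mo f)) :
    ∀ β ∈ (f - g).support, mo.lin.lt β (lmon mo f) := by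
  classical
  intro β hβ
  refine @lt_of_le_of_ne _ mo.lin.toPartialOrder _ _ ?_ ?_
  · rcases Finset.mem_union.1 (MvPolynomial.support_sub _ f g hβ) with h | h
    · exact le_lmon mo h
    · exact hg β h
  · rintro rfl
    simp [hcoeff] at hβ

theorem le_of_mem_support_monomial_mul (δ : Fin m →₀ ℕ) (c : R) (b : MvPolynomial (Fin m) R) :
    ∀ β ∈ (monomial δ c * b).support, mo.lin.le β (lmon mo b + δ) := by
  classical
  intro β hβ
  obtain ⟨d, hd, ε, hε, rfl⟩ := Finset.mem_add.1 (MvPolynomial.support_mul _ _ hβ)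
  rw [Finset.mem_singleton.1 (support_monomial_subset hd), add_comm]
  exact mo.add_le_add (le_lmon mo hε) δ

/-- `f = ∑ b ∈ F, qu b * b + r` with `r` properly reduced and all monomials bounded by `P`. -/
def IsDivision (F : Finset (MvPolynomial (Fin m) R)) (P : (Fin m →₀ ℕ) → Prop)
    (f : MvPolynomial (Fin m) R) (qu : MvPolynomial (Fin m) R → MvPolynomial (Fin m) R)
    (r : MvPolynomial (Fin m) R) : Prop :=
  f = ∑ b ∈ F, qu b * b + r ∧ ProperlyReduced mo F r ∧
    (∀ b ∈ F, ∀ δ ∈ (qu b).support, P (δ + lmon mo b)) ∧ ∀ β ∈ r.support, P β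

/-- Division with unit multiplier `1`, phrased in terms of supports. -/
theorem exists_isDivision (F : Finset (MvPolynomial (Fin m) R)) (f : MvPolynomial (Fin m) R)
    (hf : f ≠ 0) :
    ∃ qu r, IsDivision mo F (fun β => mo.lin.le β (lmon mo f)) f qu r ∧
      (lmon mo f ∈ r.support ∨
        ∃ b ∈ F, ∃ δ ∈ (qu b).support, δ + lmon mo b = lmon mo f) := by
  classical
  induction hγ : lmon mo f using mo.wf.induction generalizing f with
  | _ γ ih =>
  subst hγ
  have hfγ : f.coeff (lmon mo f) ≠ 0 := mem_support_iff.1 (lmon_mem_support mo hf)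
  have tail : ∀ g : MvPolynomial (Fin m) R, (∀ β ∈ g.support, mo.lin.lt β (lmon mo f)) →
      ∃ qu r, IsDivision mo F (fun β => mo.lin.lt β (lmon mo f)) g qu r := by
    intro g hg
    by_cases hg0 : g = 0
    · exact ⟨0, 0, by simp [hg0], by simp [ProperlyReduced], by simp, by simp⟩
    · have hlt := hg _ (lmon_mem_support mo hg0)
      obtain ⟨qu, r, ⟨h1, h2, h3, h4⟩, -⟩ := ih _ hlt g hg0 rfl
      exact ⟨qu, r, h1, h2,
        fun b hb δ hδ => @lt_of_le_of_lt _ mo.lin.toPreorder _ _ _ (h3 b hb δ hδ) hlt,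
        fun β hβ => @lt_of_le_of_lt _ mo.lin.toPreorder _ _ _ (h4 β hβ) hlt⟩
  by_cases hdiv : ∃ b ∈ F, (∃ δ, lmon mo f = lmon mo b + δ) ∧ lcoeff mo b ∣ f.coeff (lmon mo f)
  · obtain ⟨b, hb, ⟨δ, hδ⟩, c, hc⟩ := hdiv
    obtain ⟨qu, r, h1, h2, h3, h4⟩ := tail (f - monomial δ c * b)
      (lt_lmon_of_mem_support_sub mo
        (by rw [hc, hδ, add_comm, coeff_monomial_mul, _root_.lcoeff, mul_comm])
        (hδ ▸ le_of_mem_support_monomial_mul mo δ c b))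
    have hc0 : c ≠ 0 := by
      rintro rfl
      exact hfγ (by rw [hc, mul_zero])
    refine ⟨qu + Pi.single b (monomial δ c), r, ⟨?_, h2, ?_, ?_⟩, Or.inr ⟨b, hb, δ, ?_, ?_⟩⟩
    · rw [sub_eq_iff_eq_add] at h1
      rw [h1]
      simp only [Pi.add_apply, add_mul, Finset.sum_add_distrib, Pi.single_apply, ite_mul, zero_mul,
        Finset.sum_ite_eq', hb, if_true]
      ring
    · intro b' hb' ε hε
      rcases Finset.mem_union.1 (support_add hε) with h | h
      · exact @le_of_lt _ mo.lin.toPreorder _ _ (h3 b' hb' ε h)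
      · obtain rfl | hne := eq_or_ne b' b
        · rw [Pi.single_eq_same] at h
          rw [Finset.mem_singleton.1 (support_monomial_subset h), hδ, add_comm]
          exact mo.lin.le_refl _
        · simp [Pi.single_eq_of_ne hne] at h
    · exact fun β hβ => @le_of_lt _ mo.lin.toPreorder _ _ (h4 β hβ)
    · have : δ ∉ (qu b).support := fun h =>
        @lt_irrefl _ mo.lin.toPreorder _ (by simpa only [hδ, add_comm] using h3 b hb δ h)
      rw [mem_support_iff, Pi.add_apply, Pi.single_eq_same, coeff_add, notMem_support_iff.1 this,
        coeff_monomial, if_pos rfl, zero_add]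
      exact hc0
    · rw [hδ, add_comm]
  · obtain ⟨qu, r, h1, h2, h3, h4⟩ := tail (f - lterm mo f)
      (lt_lmon_of_mem_support_sub mo (by rw [lterm, coeff_monomial, if_pos rfl, _root_.lcoeff])
        (fun β hβ => by
          rw [Finset.mem_singleton.1 (support_monomial_subset hβ)]
          exact mo.lin.le_refl _))
    have hr : r.coeff (lmon mo f) = 0 :=
      notMem_support_iff.1 fun h => @lt_irrefl _ mo.lin.toPreorder _ (h4 _ h)
    have hcoeff : (r + lterm mo f).coeff (lmon mo f) = f.coeff (lmon mo f) := by
      rw [coeff_add, hr, lterm, coeff_monomial, if_pos rfl, zero_add, _root_.lcoeff]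
    have hcoeff' : ∀ β ≠ lmon mo f, (r + lterm mo f).coeff β = r.coeff β := fun β hβ => by
      rw [coeff_add, lterm, coeff_monomial, if_neg hβ.symm, add_zero]
    refine ⟨qu, r + lterm mo f, ⟨?_, ?_, ?_, ?_⟩, Or.inl ?_⟩
    · rw [← add_assoc, ← h1, sub_add_cancel]
    · intro α hα
      obtain rfl | hne := eq_or_ne α (lmon mo f)
      · rwa [hcoeff]
      · rw [mem_support_iff, hcoeff' α hne] at hα
        rw [hcoeff' α hne]
        exact h2 α (mem_support_iff.2 hα)
    · exact fun b hb δ hδ => @le_of_lt _ mo.lin.toPreorder _ _ (h3 b hb δ hδ)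
    · intro β hβ
      obtain rfl | hne := eq_or_ne β (lmon mo f)
      · exact mo.lin.le_refl _
      · rw [mem_support_iff, hcoeff' β hne] at hβ
        exact @le_of_lt _ mo.lin.toPreorder _ _ (h4 β (mem_support_iff.2 hβ))
    · rwa [mem_support_iff, hcoeff]

end Division

/-- Proper division over `R̄ = K[x₁]/⟨q⟩`: for a finite set `F` of nonconstant polynomials
and any `f`, there are a unit multiplier `λ`, quotients and a properly reduced remainder
with `λ·f = Σ q_j·f_j + r` and `lm f = max{max_j lm(q_j)·lm(f_j), lm r}` over the nonzero
`q_j` and nonzero `r`. -/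
theorem proper_division {K : Type*} [Field K]
    (q : Polynomial K) (hq : 0 < q.natDegree)
    (mo : MonomialOrdering m)
    (F : Finset (MvPolynomial (Fin m) (Polynomial K ⧸ Ideal.span {q})))
    (hFne : F.Nonempty) (hFnc : ∀ b ∈ F, Nonconst b)
    (f : MvPolynomial (Fin m) (Polynomial K ⧸ Ideal.span {q})) :
    ∃ (lam : Polynomial K ⧸ Ideal.span {q})
      (qu : MvPolynomial (Fin m) (Polynomial K ⧸ Ideal.span {q}) →
        MvPolynomial (Fin m) (Polynomial K ⧸ Ideal.span {q}))
      (r : MvPolynomial (Fin m) (Polynomial K ⧸ Ideal.span {q})),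
      IsUnit lam ∧
      MvPolynomial.C lam * f = (∑ b ∈ F, qu b * b) + r ∧
      ProperlyReduced mo F r ∧
      (∀ b ∈ F, qu b ≠ 0 → mo.lin.le (lmon mo (qu b) + lmon mo b) (lmon mo f)) ∧
      (r ≠ 0 → mo.lin.le (lmon mo r) (lmon mo f)) ∧
      (f ≠ 0 → (r ≠ 0 ∧ lmon mo r = lmon mo f) ∨
        ∃ b ∈ F, qu b ≠ 0 ∧ lmon mo (qu b) + lmon mo b = lmon mo f) := by
  by_cases hf : f = 0
  · exact ⟨1, 0, 0, isUnit_one, by simp [hf], by simp [ProperlyReduced], by simp, by simp,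
      fun h => absurd hf h⟩
  obtain ⟨qu, r, ⟨h1, h2, h3, h4⟩, h5⟩ := exists_isDivision mo F f hf
  refine ⟨1, qu, r, isUnit_one, by rw [C_1, one_mul]; exact h1, h2,
    fun b hb hq0 => h3 b hb _ (lmon_mem_support mo hq0),
    fun hr => h4 _ (lmon_mem_support mo hr), fun _ => ?_⟩
  rcases h5 with h | ⟨b, hb, δ, hδ, hsum⟩
  · have hr : r ≠ 0 := by
      rintro rfl
      simp at h
    exact Or.inl ⟨hr, mo.lin.le_antisymm _ _ (h4 _ (lmon_mem_support mo hr)) (le_lmon mo h)⟩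
  · have hq0 : qu b ≠ 0 := by
      intro h
      simp [h] at hδ
    exact Or.inr ⟨b, hb, hq0, mo.lin.le_antisymm _ _ (h3 b hb _ (lmon_mem_support mo hq0))
      (hsum ▸ mo.add_le_add (le_lmon mo hδ) (lmon mo b))⟩
end

section
/- Let K be a field, q ∈ K[x_1] nonconstant, R̄ = K[x_1]/⟨q⟩, fix a monomial ordering on the x̃-monomials, and let J be an ideal of R̄[x̃]. Call a finite set B ⊂ J of nonconstant polynomials (B ⊂ R̄[x̃] \ R̄) an irredundant basis of J if ⟨{lt(f) : f ∈ J \ {0}}⟩ = ⟨{lt(b) : b ∈ B}⟩ and, for every b ∈ B, ⟨{lt(b') : b' ∈ B \ {b}}⟩ is a proper subset of ⟨{lt(b') : b' ∈ B}⟩ (equivalently, lt(b) is gcd-reduced with respect to B \ {b}). If B and B′ are irredundant bases of the same ideal J, then lm(B) = lm(B′) as sets of monomials. -/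
open MvPolynomial Classical

variable {m : ℕ}

/-- The ideal generated by the leading terms of the elements of `B`. -/
noncomputable def ltSpan {R : Type*} [CommRing R] (mo : MonomialOrdering m)
    (B : Finset (MvPolynomial (Fin m) R)) : Ideal (MvPolynomial (Fin m) R) :=
  Ideal.span ((fun b => lterm mo b) '' (↑B : Set (MvPolynomial (Fin m) R)))

/-- `B` is an irredundant basis of the ideal `J`: `B` is a finite set of nonconstant
elements of `J` with `⟨lt(J \ {0})⟩ = ⟨lt(B)⟩`, and removing any element of `B` strictly
shrinks the ideal generated by the leading terms. -/
def IsIrredundantBasis {R : Type*} [CommRing R] (mo : MonomialOrdering m)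
    (J : Ideal (MvPolynomial (Fin m) R)) (B : Finset (MvPolynomial (Fin m) R)) : Prop :=
  (∀ b ∈ B, b ∈ J) ∧ (∀ b ∈ B, Nonconst b) ∧
  Ideal.span {p : MvPolynomial (Fin m) R | ∃ f ∈ J, f ≠ 0 ∧ p = lterm mo f} = ltSpan mo B ∧
  ∀ b ∈ B, ltSpan mo (B.erase b) < ltSpan mo B

theorem monomial_coeff_mem_span_lterm {R : Type*} [CommRing R] (mo : MonomialOrdering m)
    (S : Set (MvPolynomial (Fin m) R)) {p : MvPolynomial (Fin m) R}
    (hp : p ∈ Ideal.span (lterm mo '' S)) (β : Fin m →₀ ℕ) :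
    monomial β (coeff β p) ∈ Ideal.span (lterm mo '' {b ∈ S | lmon mo b ≤ β}) := by
  induction hp using Submodule.span_induction generalizing β with
  | mem x hx =>
    obtain ⟨b, hb, rfl⟩ := hx
    by_cases h : lmon mo b = β
    · have hmem : lterm mo b ∈ Ideal.span (lterm mo '' {b ∈ S | lmon mo b ≤ β}) :=
        Ideal.subset_span ⟨b, ⟨hb, h.le⟩, rfl⟩
      subst h
      simpa [lterm, coeff_monomial] using hmem
    · simp [lterm, coeff_monomial, h]
  | zero => simp
  | add x y _ _ ihx ihy =>
    rw [coeff_add, map_add]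
    exact add_mem (ihx β) (ihy β)
  | smul a x _ ih =>
    rw [smul_eq_mul, coeff_mul, map_sum]
    refine sum_mem fun ij hij => ?_
    rw [Finset.HasAntidiagonal.mem_antidiagonal] at hij
    rw [← hij, ← monomial_mul]
    refine Ideal.mul_mem_left _ _ (Ideal.span_mono (Set.image_mono ?_) (ih ij.2))
    exact fun b hb => ⟨hb.1, hb.2.trans le_add_self⟩

/-- If no element of `B` can be removed without shrinking the ideal of leading terms, then the
leading monomials of `B` are those monomials `α` for which some term `c x^α` in this ideal is not
generated by the terms of the ideal with exponent strictly dividing `α`. -/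
theorem mem_image_lmon_iff {R : Type*} [CommRing R] (mo : MonomialOrdering m)
    {B : Finset (MvPolynomial (Fin m) R)}
    (hB : ∀ b ∈ B, ltSpan mo (B.erase b) < ltSpan mo B) (α : Fin m →₀ ℕ) :
    α ∈ (fun b => lmon mo b) '' (↑B : Set (MvPolynomial (Fin m) R)) ↔
      ∃ c : R, monomial α c ∈ ltSpan mo B ∧ monomial α c ∉
        Ideal.span {p | ∃ β < α, ∃ d : R, p = monomial β d ∧ p ∈ ltSpan mo B} := by
  constructor
  · rintro ⟨b, hb, rfl⟩
    refine ⟨lcoeff mo b, Ideal.subset_span ⟨b, hb, rfl⟩, fun hmem => (hB b hb).not_ge ?_⟩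
    have hlt : lterm mo b ∈ ltSpan mo (B.erase b) := by
      refine Ideal.span_le.mpr ?_ hmem
      rintro _ ⟨β, hβ, d, rfl, hd⟩
      have h := monomial_coeff_mem_span_lterm mo _ hd β
      rw [coeff_monomial, if_pos rfl] at h
      refine Ideal.span_mono (Set.image_mono ?_) h
      rintro b' ⟨hb', hle⟩
      refine Finset.mem_coe.mpr (Finset.mem_erase.mpr ⟨?_, hb'⟩)
      rintro rfl
      exact hβ.not_ge hle
    refine Ideal.span_le.mpr ?_
    rintro _ ⟨b', hb', rfl⟩
    by_cases h : b' = b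
    · exact h ▸ hlt
    · exact Ideal.subset_span ⟨b', Finset.mem_erase.mpr ⟨h, hb'⟩, rfl⟩
  · rintro ⟨c, hc, hnot⟩
    by_contra hα
    refine hnot ?_
    have h := monomial_coeff_mem_span_lterm mo _ hc α
    rw [coeff_monomial, if_pos rfl] at h
    refine Ideal.span_mono ?_ h
    rintro _ ⟨b, ⟨hb, hle⟩, rfl⟩
    exact ⟨lmon mo b, lt_of_le_of_ne hle fun he => hα ⟨b, hb, he⟩, lcoeff mo b, rfl,
      Ideal.subset_span ⟨b, hb, rfl⟩⟩

/-- Two irredundant bases of the same ideal of `R̄[x̃]`, `R̄ = K[x₁]/⟨q⟩`, have the same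
set of leading monomials. -/
theorem irredundant_bases_leadMonomials_eq {K : Type*} [Field K]
    (q : Polynomial K) (hq : 0 < q.natDegree)
    (mo : MonomialOrdering m)
    (J : Ideal (MvPolynomial (Fin m) (Polynomial K ⧸ Ideal.span {q})))
    (B B' : Finset (MvPolynomial (Fin m) (Polynomial K ⧸ Ideal.span {q})))
    (hB : IsIrredundantBasis mo J B) (hB' : IsIrredundantBasis mo J B') :
    (fun b => lmon mo b) '' (↑B : Set (MvPolynomial (Fin m) (Polynomial K ⧸ Ideal.span {q})))
      = (fun b => lmon mo b) ''
          (↑B' : Set (MvPolynomial (Fin m) (Polynomial K ⧸ Ideal.span {q}))) := by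
  ext α
  rw [mem_image_lmon_iff mo hB.2.2.2, mem_image_lmon_iff mo hB'.2.2.2,
    ← hB.2.2.1, ← hB'.2.2.1]
end
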